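/- Fix q ∈ (0,1), integers N, k ≥ 1 and a_1,…,a_N ∈ ℝ. Suppose f : ℤ^k → ℝ satisfies: for every i ∈ {1,…,k−1} and every n⃗ ∈ ℤ^k with n_i = n_{i+1}, ([∇]_i − q [∇]_{i+1}) f(n⃗) = 0. Then for all integers N ≥ n_1 ≥ n_2 ≥ ⋯ ≥ n_k > 0, writing y⃗ = y⃗(n⃗) ∈ Y^N_k: ([∇_{a_{n_1}}]_1 ⋯ [∇_{a_{n_k}}]_k f)(n⃗) = ∑_{s_1=0}^{y_1} C_{a_1}(y_1,s_1) ∑_{s_2=0}^{y_2} C_{a_2}(y_2,s_2) ⋯ ∑_{s_N=0}^{y_N} C_{a_N}(y_N,s_N) f(n⃗(y⃗^{s⃗})). -/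

import Mathlib

/-- The q-Pochhammer symbol `(a;q)_n = ∏_{i=0}^{n-1} (1 - a q^i)`. -/
noncomputable def qPoch (q a : ℝ) (n : ℕ) : ℝ := ∏ i ∈ Finset.range n, (1 - a * q ^ i)

/-- The coefficients `C_a(y,s)`, with the convention `C_a(y,s) = 0` for `s < 0` or `s > y`. -/
noncomputable def Cco (q a : ℝ) (y : ℕ) (s : ℤ) : ℝ :=
  if 0 ≤ s ∧ s ≤ (y : ℤ) then
    (-a) ^ s.toNat * qPoch q (-a) (y - s.toNat) *
      (qPoch q q y / (qPoch q q (y - s.toNat) * qPoch q q s.toNat))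
  else 0

/-- `([∇]_i f)(n⃗) = f(n⃗ - e_i) - f(n⃗)`. -/
noncomputable def nablaD {k : ℕ} (i : Fin k) (f : (Fin k → ℤ) → ℝ) (n : Fin k → ℤ) : ℝ :=
  f (Function.update n i (n i - 1)) - f n

/-- `([∇_x]_i f)(n⃗) = (1+x) f(n⃗) - x f(n⃗ - e_i)`. -/
noncomputable def nablaX {k : ℕ} (x : ℝ) (i : Fin k) (f : (Fin k → ℤ) → ℝ)
    (n : Fin k → ℤ) : ℝ :=
  (1 + x) * f n - x * f (Function.update n i (n i - 1))

/-- `n⃗(y⃗) ∈ ℤ^k`: the weakly decreasing vector containing exactly `y_v` entries equal to `v`;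
`n_j` is the largest `v` with `y_v + y_{v+1} + ⋯ + y_N > j` (0-indexed `j`). -/
def nvec (N k : ℕ) (y : Fin (N + 1) → ℕ) (j : Fin k) : ℕ :=
  (Finset.univ.filter
    (fun v : Fin (N + 1) => (j : ℕ) < ∑ i ∈ Finset.Ici v, y i)).sup (fun v => (v : ℕ))

/-- `y⃗(n⃗)`: the multiplicities `y_v = #{j : n_j = v}`. -/
def ycount {k : ℕ} (N : ℕ) (n : Fin k → ℤ) (v : Fin (N + 1)) : ℕ :=
  (Finset.univ.filter (fun j : Fin k => n j = ((v : ℕ) : ℤ))).card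

/-- `y⃗^{s⃗} = (y_0+s_1, y_1+s_2-s_1, …, y_{N-1}+s_N-s_{N-1}, y_N-s_N)`, where `s i` denotes
the paper variable `s_{i+1}` for `i : Fin N`. -/
def yshift {N : ℕ} (y : Fin (N + 1) → ℕ) (s : Fin N → ℕ) (v : Fin (N + 1)) : ℕ :=
  (y v - (if h : 0 < (v : ℕ) then s ⟨(v : ℕ) - 1, by have := v.isLt; omega⟩ else 0))
    + (if h : (v : ℕ) < N then s ⟨(v : ℕ), h⟩ else 0)

/-- Expansion of `∏ ((1 + a c) c - a c (c - 1))` over the letters `c` of a word, as a signed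
combination of words, evaluated through `F`. -/
noncomputable def wordExpand (a : ℤ → ℝ) : List ℤ → (List ℤ → ℝ) → ℝ
  | [], F => F []
  | c :: l, F => (1 + a c) * wordExpand a l (fun w => F (c :: w)) -
      a c * wordExpand a l (fun w => F ((c - 1) :: w))

/-- The exchange relation `(c-1) c = q c (c-1) + (1-q) c c`, applied inside arbitrary words. -/
def Exchange (q : ℝ) (F : List ℤ → ℝ) : Prop :=
  ∀ (u w : List ℤ) (c : ℤ),
    F (u ++ (c - 1) :: c :: w) = q * F (u ++ c :: (c - 1) :: w) + (1 - q) * F (u ++ c :: c :: w)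

/-- The weakly decreasing word with `z v` letters equal to `v`, for `v ≤ N`. -/
def sortedWord (z : ℕ → ℕ) : ℕ → List ℤ
  | 0 => List.replicate (z 0) 0
  | N + 1 => List.replicate (z (N + 1)) ((N + 1 : ℕ) : ℤ) ++ sortedWord z N

/-- The word obtained by lowering the last `s (v - 1)` of the `y v` letters equal to `v`,
for `1 ≤ v ≤ N`. -/
def loweredWord (y s : ℕ → ℕ) : ℕ → List ℤ
  | 0 => []
  | N + 1 => List.replicate (y (N + 1) - s N) ((N + 1 : ℕ) : ℤ) ++
      (List.replicate (s N) (N : ℤ) ++ loweredWord y s N)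

lemma Exchange.append_left {q : ℝ} {F : List ℤ → ℝ} (h : Exchange q F) (p : List ℤ) :
    Exchange q (fun w => F (p ++ w)) := by
  intro u w c
  simpa using h (p ++ u) w c

lemma Exchange.cons {q : ℝ} {F : List ℤ → ℝ} (h : Exchange q F) (x : ℤ) :
    Exchange q (fun w => F (x :: w)) := h.append_left [x]

lemma Exchange.replicate {q : ℝ} (c : ℤ) (w : List ℤ) (m : ℕ) {F : List ℤ → ℝ}
    (h : Exchange q F) :
    F ((c - 1) :: (List.replicate m c ++ w)) =
      q ^ m * F (List.replicate m c ++ (c - 1) :: w) +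
        (1 - q ^ m) * F (c :: (List.replicate m c ++ w)) := by
  induction m generalizing F with
  | zero => simp
  | succ m ih =>
    have h1 := h [] (List.replicate m c ++ w) c
    have h2 := ih (h.cons c)
    simp only [List.replicate_succ, List.cons_append, List.nil_append] at *
    rw [h1, h2]
    ring

lemma wordExpand_append (a : ℤ → ℝ) (l₁ l₂ : List ℤ) (F : List ℤ → ℝ) :
    wordExpand a (l₁ ++ l₂) F =
      wordExpand a l₁ (fun u => wordExpand a l₂ (fun w => F (u ++ w))) := by
  induction l₁ generalizing F with
  | nil => simp [wordExpand]
  | cons c l ih => simp [wordExpand, ih]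

lemma wordExpand_exchange {q : ℝ} (a : ℤ → ℝ) (l : List ℤ) {F : List ℤ → ℝ}
    (h : Exchange q F) : Exchange q (fun u => wordExpand a l (fun w => F (u ++ w))) := by
  induction l generalizing F with
  | nil => simpa [wordExpand] using h
  | cons c l ih =>
    have key : ∀ x : ℤ, Exchange q (fun u => wordExpand a l (fun w => F (u ++ x :: w))) := by
      intro x u w d
      simpa using ih h u (w ++ [x]) d
    intro u w d
    have h1 := key c u w d
    have h2 := key (c - 1) u w d
    simp only [wordExpand] at h1 h2 ⊢
    rw [h1, h2]
    ring

lemma qPoch_succ (q a : ℝ) (n : ℕ) : qPoch q a (n + 1) = qPoch q a n * (1 - a * q ^ n) :=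
  Finset.prod_range_succ _ _

lemma qPoch_zero (q a : ℝ) : qPoch q a 0 = 1 := Finset.prod_range_zero _

lemma one_sub_mul_pow_ne_zero {q : ℝ} (hq : q ∈ Set.Ioo (0 : ℝ) 1) (n : ℕ) :
    1 - q * q ^ n ≠ 0 := by
  have := pow_lt_one₀ hq.1.le hq.2 (Nat.succ_ne_zero n)
  rw [pow_succ'] at this
  exact (sub_pos.2 this).ne'

lemma qPoch_self_ne_zero {q : ℝ} (hq : q ∈ Set.Ioo (0 : ℝ) 1) (n : ℕ) : qPoch q q n ≠ 0 :=
  Finset.prod_ne_zero_iff.2 fun i _ => one_sub_mul_pow_ne_zero hq i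

lemma Cco_add (q a : ℝ) (m s : ℕ) : Cco q a (m + s) (s : ℤ) =
    (-a) ^ s * qPoch q (-a) m * (qPoch q q (m + s) / (qPoch q q m * qPoch q q s)) := by
  simp [Cco]

lemma Cco_of_lt (q a : ℝ) {y s : ℕ} (h : y < s) : Cco q a y (s : ℤ) = 0 := by
  rw [Cco, if_neg]
  omega

lemma Cco_succ_zero {q : ℝ} (hq : q ∈ Set.Ioo (0 : ℝ) 1) (a : ℝ) (y : ℕ) :
    Cco q a (y + 1) ((0 : ℕ) : ℤ) = (1 + a * q ^ y) * Cco q a y ((0 : ℕ) : ℤ) := by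
  have h1 := Cco_add q a (y + 1) 0
  have h2 := Cco_add q a y 0
  simp only [add_zero] at h1 h2
  have h3 := qPoch_self_ne_zero hq y
  have h4 := qPoch_self_ne_zero hq (y + 1)
  rw [h1, h2]
  simp only [qPoch_zero]
  field_simp
  rw [qPoch_succ]
  ring

lemma Cco_succ_succ {q : ℝ} (hq : q ∈ Set.Ioo (0 : ℝ) 1) (a : ℝ) {y s : ℕ} (hs : s ≤ y) :
    Cco q a (y + 1) ((s + 1 : ℕ) : ℤ) =
      (1 + a * q ^ (y - (s + 1))) * Cco q a y ((s + 1 : ℕ) : ℤ) -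
        a * q ^ (y - s) * Cco q a y (s : ℤ) := by
  obtain ⟨m, rfl⟩ := Nat.exists_eq_add_of_le' hs
  have n1 := qPoch_self_ne_zero hq s
  have n2 := one_sub_mul_pow_ne_zero hq s
  rw [add_assoc, Cco_add, Cco_add]
  rcases m with _ | m
  · rw [Cco_of_lt q a (by omega)]
    simp only [zero_add, qPoch_succ, qPoch_zero, Nat.sub_self]
    field_simp
    ring
  · have e1 : m + 1 + s = m + (s + 1) := by omega
    have e2 : m + 1 + (s + 1) = (m + (s + 1)) + 1 := by omega
    have e3 : m + (s + 1) - s = m + 1 := by omega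
    have n3 := qPoch_self_ne_zero hq m
    have n4 := one_sub_mul_pow_ne_zero hq m
    rw [e2, e1, e3, Nat.add_sub_cancel, Cco_add]
    simp only [qPoch_succ, pow_add, pow_one]
    have n5 : 1 - q ^ m * q ≠ 0 := by rwa [mul_comm]
    field_simp
    ring

lemma wordExpand_replicate {q : ℝ} (hq : q ∈ Set.Ioo (0 : ℝ) 1) (a : ℤ → ℝ) (c : ℤ) (y : ℕ)
    {F : List ℤ → ℝ} (h : Exchange q F) :
    wordExpand a (List.replicate y c) F = ∑ s ∈ Finset.range (y + 1),
      Cco q (a c) y (s : ℤ) * F (List.replicate (y - s) c ++ List.replicate s (c - 1)) := by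
  induction y generalizing F with
  | zero => simp [wordExpand, Cco, qPoch]
  | succ y ih =>
    set g : ℕ → ℝ := fun s => F (List.replicate (y + 1 - s) c ++ List.replicate s (c - 1)) with hg
    have step : wordExpand a (List.replicate (y + 1) c) F =
        ∑ s ∈ Finset.range (y + 1), ((1 + a c * q ^ (y - s)) * Cco q (a c) y (s : ℤ) * g s -
          a c * q ^ (y - s) * Cco q (a c) y (s : ℤ) * g (s + 1)) := by
      rw [List.replicate_succ, wordExpand, ih (h.cons c), ih (h.cons (c - 1)), Finset.mul_sum,
        Finset.mul_sum, ← Finset.sum_sub_distrib]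
      refine Finset.sum_congr rfl fun s hs => ?_
      have hs' : s ≤ y := by simpa [Nat.lt_succ_iff] using hs
      have e1 : y + 1 - s = (y - s) + 1 := by omega
      have e2 : y + 1 - (s + 1) = y - s := by omega
      simp only [hg, e1, e2]
      rw [h.replicate c (List.replicate s (c - 1)) (y - s)]
      simp only [List.replicate_succ, List.cons_append]
      ring
    have e : ∀ s ∈ Finset.range (y + 1), Cco q (a c) (y + 1) ((s + 1 : ℕ) : ℤ) * g (s + 1) =
        (1 + a c * q ^ (y - (s + 1))) * Cco q (a c) y ((s + 1 : ℕ) : ℤ) * g (s + 1) -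
          a c * q ^ (y - s) * Cco q (a c) y (s : ℤ) * g (s + 1) := by
      intro s hs
      rw [Cco_succ_succ hq _ (by simpa [Nat.lt_succ_iff] using hs)]
      ring
    rw [step, Finset.sum_sub_distrib, Finset.sum_range_succ' (fun s : ℕ =>
      Cco q (a c) (y + 1) (s : ℤ) * g s), Finset.sum_congr rfl e, Finset.sum_sub_distrib,
      Cco_succ_zero hq]
    have := Finset.sum_range_succ' (fun s : ℕ =>
      (1 + a c * q ^ (y - s)) * Cco q (a c) y (s : ℤ) * g s) (y + 1)
    rw [Finset.sum_range_succ, Cco_of_lt q (a c) (Nat.lt_succ_self y)] at this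
    simp only [mul_zero, zero_mul, add_zero, Nat.sub_zero] at this
    rw [this]
    ring

lemma sum_piFinset_snoc {M : ℕ} (A : Fin (M + 1) → Finset ℕ) (G : (Fin (M + 1) → ℕ) → ℝ) :
    ∑ s ∈ Fintype.piFinset A, G s = ∑ t ∈ A (Fin.last M),
      ∑ s ∈ Fintype.piFinset (fun i : Fin M => A i.castSucc),
        G (Fin.snoc (α := fun _ => ℕ) s t) := by
  rw [Finset.sum_sigma']
  refine Finset.sum_bij' (fun s _ => ⟨s (Fin.last M), Fin.init s⟩)
    (fun p _ => Fin.snoc (α := fun _ => ℕ) p.2 p.1) ?_ ?_ ?_ ?_ ?_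
  · intro s hs
    simp only [Fintype.mem_piFinset, Finset.mem_sigma] at hs ⊢
    exact ⟨hs _, fun i => hs _⟩
  · rintro ⟨t, s⟩ hs
    simp only [Fintype.mem_piFinset, Finset.mem_sigma] at hs ⊢
    intro i
    refine Fin.lastCases ?_ (fun j => ?_) i
    · simpa using hs.1
    · simpa using hs.2 j
  · intro s _
    simp
  · rintro ⟨t, s⟩ _
    simp
  · intro s _
    simp

/-- Extension by zero of a tuple to a sequence. -/
def extendZero {M : ℕ} (s : Fin M → ℕ) (v : ℕ) : ℕ := if h : v < M then s ⟨v, h⟩ else 0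

lemma loweredWord_congr (y : ℕ → ℕ) {s s' : ℕ → ℕ} {M : ℕ} (h : ∀ v < M, s v = s' v) :
    loweredWord y s M = loweredWord y s' M := by
  induction M with
  | zero => rfl
  | succ M ih =>
    rw [loweredWord, loweredWord, h M (Nat.lt_succ_self M), ih fun v hv => h v (by omega)]

lemma wordExpand_sortedWord {q : ℝ} (hq : q ∈ Set.Ioo (0 : ℝ) 1) (a : ℤ → ℝ) (y : ℕ → ℕ)
    (hy : y 0 = 0) (M : ℕ) {F : List ℤ → ℝ} (h : Exchange q F) :
    wordExpand a (sortedWord y M) F =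
      ∑ s ∈ Fintype.piFinset (fun i : Fin M => Finset.range (y (i + 1) + 1)),
        (∏ i : Fin M, Cco q (a ((i : ℕ) + 1)) (y (i + 1)) (s i : ℤ)) *
          F (loweredWord y (extendZero s) M) := by
  induction M generalizing F with
  | zero => simp [sortedWord, hy, wordExpand, loweredWord]
  | succ M ih =>
    rw [sortedWord, wordExpand_append, wordExpand_replicate hq _ _ _ (wordExpand_exchange a _ h),
      sum_piFinset_snoc]
    refine Finset.sum_congr rfl fun t _ => ?_
    rw [ih (h.append_left _), Finset.mul_sum]
    refine Finset.sum_congr rfl fun s _ => ?_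
    have h1 : extendZero (Fin.snoc (α := fun _ => ℕ) s t) M = t := by
      simp [extendZero, Fin.snoc]
    have h2 : loweredWord y (extendZero (Fin.snoc (α := fun _ => ℕ) s t)) M =
        loweredWord y (extendZero s) M :=
      loweredWord_congr y fun v hv => by
        simp [extendZero, Fin.snoc, hv, Nat.lt_succ_of_lt hv]
    rw [Fin.prod_univ_castSucc, loweredWord, h1, h2]
    simp [List.append_assoc]
    ring

lemma sortedWord_congr {z z' : ℕ → ℕ} {M : ℕ} (h : ∀ v ≤ M, z v = z' v) :
    sortedWord z M = sortedWord z' M := by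
  induction M with
  | zero => rw [sortedWord, sortedWord, h 0 le_rfl]
  | succ M ih => rw [sortedWord, sortedWord, h _ le_rfl, ih fun v hv => h v (by omega)]

lemma replicate_append_loweredWord (y s : ℕ → ℕ) (hy : y 0 = 0) (M t : ℕ) :
    List.replicate t (M : ℤ) ++ loweredWord y s M =
      sortedWord (fun v => (y v - if 0 < v then s (v - 1) else 0) +
        if v < M then s v else if v = M then t else 0) M := by
  induction M generalizing t with
  | zero => simp [loweredWord, sortedWord, hy]
  | succ M ih =>
    rw [loweredWord, ih, sortedWord, ← List.append_assoc, ← List.replicate_add]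
    congr 1
    · simp [add_comm]
    · refine sortedWord_congr fun v hv => ?_
      rcases hv.lt_or_eq with hv | rfl
      · simp [hv, Nat.lt_succ_of_lt hv]
      · simp

lemma length_loweredWord {y s : ℕ → ℕ} (hy : y 0 = 0) {M : ℕ} (h : ∀ v < M, s v ≤ y (v + 1)) :
    (loweredWord y s M).length = (sortedWord y M).length := by
  induction M with
  | zero => simp [loweredWord, sortedWord, hy]
  | succ M ih =>
    have h1 := h M (Nat.lt_succ_self M)
    simp only [loweredWord, sortedWord, List.length_append, List.length_replicate,
      ih fun v hv => h v (by omega)]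
    omega

lemma mem_sortedWord {z : ℕ → ℕ} {M : ℕ} {x : ℤ} (h : x ∈ sortedWord z M) :
    0 ≤ x ∧ x ≤ M := by
  induction M with
  | zero => simp [sortedWord] at h; simp [h.2]
  | succ M ih =>
    rw [sortedWord, List.mem_append, List.mem_replicate] at h
    rcases h with ⟨_, rfl⟩ | h
    · omega
    · have := ih h
      omega

lemma pairwise_sortedWord (z : ℕ → ℕ) (M : ℕ) : (sortedWord z M).Pairwise (· ≥ ·) := by
  induction M with
  | zero => simp [sortedWord, List.pairwise_replicate]
  | succ M ih =>
    rw [sortedWord, List.pairwise_append]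
    refine ⟨by simp [List.pairwise_replicate], ih, fun x hx y hy => ?_⟩
    have := mem_sortedWord hy
    have := List.eq_of_mem_replicate hx
    omega

lemma count_sortedWord (z : ℕ → ℕ) (M v : ℕ) :
    (sortedWord z M).count (v : ℤ) = if v ≤ M then z v else 0 := by
  induction M with
  | zero => rcases v with _ | v <;> simp [sortedWord, List.count_replicate]; omega
  | succ M ih =>
    rw [sortedWord, List.count_append, ih, List.count_replicate]
    rcases lt_trichotomy v (M + 1) with h | rfl | h
    · have : ¬ (M + 1 = v) := by omega
      simp [show v ≤ M by omega, show v ≤ M + 1 by omega]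
      omega
    · simp
    · simp [show ¬ v ≤ M by omega, show ¬ v ≤ M + 1 by omega]
      omega

lemma le_getD_sortedWord (z : ℕ → ℕ) (M : ℕ) {v : ℕ} (hv : 1 ≤ v) (j : ℕ) :
    (v : ℤ) ≤ (sortedWord z M).getD j 0 ↔ j < ∑ i ∈ Finset.Icc v M, z i := by
  induction M generalizing j with
  | zero =>
    have : (List.replicate (z 0) (0 : ℤ)).getD j 0 = 0 := by
      rw [List.getD_eq_getElem?_getD, List.getElem?_replicate]
      split_ifs <;> rfl
    rw [sortedWord, this, Finset.Icc_eq_empty (by omega)]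
    simp
    omega
  | succ M ih =>
    rw [sortedWord]
    rcases lt_or_ge j (z (M + 1)) with hj | hj
    · rw [List.getD_append _ _ _ _ (by simpa using hj)]
      have : (List.replicate (z (M + 1)) ((M + 1 : ℕ) : ℤ)).getD j 0 = ((M + 1 : ℕ) : ℤ) := by
        simp [List.getD_eq_getElem?_getD, hj]
      rw [this]
      by_cases hvM : v ≤ M + 1
      · rw [Finset.sum_Icc_succ_top hvM]
        constructor <;> intro <;> omega
      · rw [Finset.Icc_eq_empty hvM]
        simp
        omega
    · rw [List.getD_append_right _ _ _ _ (by simpa using hj), ih, List.length_replicate]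
      by_cases hvM : v ≤ M + 1
      · rw [Finset.sum_Icc_succ_top hvM]
        omega
      · rw [Finset.Icc_eq_empty hvM, Finset.Icc_eq_empty (by omega)]
        simp

lemma nvec_eq_getD_sortedWord (N k : ℕ) (z : ℕ → ℕ) (j : Fin k) :
    (nvec N k (fun v => z v) j : ℤ) = (sortedWord z N).getD j 0 := by
  have hsum : ∀ v : Fin (N + 1), ∑ i ∈ Finset.Ici v, z i = ∑ i ∈ Finset.Icc (v : ℕ) N, z i := by
    intro v
    refine Finset.sum_bij (fun i _ => (i : ℕ)) ?_ ?_ ?_ ?_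
    · intro i hi
      have : (v : ℕ) ≤ i := by simpa using hi
      simp; omega
    · intro i _ j _ h
      exact Fin.ext h
    · intro i hi
      simp only [Finset.mem_Icc] at hi
      exact ⟨⟨i, by omega⟩, by simpa [Fin.le_def] using hi.1, rfl⟩
    · intro i _
      rfl
  have hb : 0 ≤ (sortedWord z N).getD j 0 ∧ (sortedWord z N).getD j 0 ≤ N := by
    rcases lt_or_ge (j : ℕ) (sortedWord z N).length with h | h
    · rw [List.getD_eq_getElem _ _ h]
      exact mem_sortedWord (List.getElem_mem h)
    · rw [List.getD_eq_default _ _ h]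
      simp
  obtain ⟨x, hx⟩ := Int.eq_ofNat_of_zero_le hb.1
  have key := fun (v : ℕ) (hv : 1 ≤ v) => le_getD_sortedWord z N hv j
  rw [hx] at hb key ⊢
  norm_cast at *
  rw [nvec]
  apply le_antisymm
  · refine Finset.sup_le fun v hv => ?_
    rw [Finset.mem_filter, hsum] at hv
    rcases Nat.eq_zero_or_pos (v : ℕ) with h0 | h0
    · omega
    · exact (key v h0).2 hv.2
  · rcases Nat.eq_zero_or_pos x with h0 | h0
    · omega
    · refine Finset.le_sup (f := fun v : Fin (N + 1) => (v : ℕ)) (b := ⟨x, by omega⟩) ?_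
      rw [Finset.mem_filter, hsum]
      exact ⟨Finset.mem_univ _, (key x h0).1 le_rfl⟩

lemma foldr_nablaX_cons {k : ℕ} (b : Fin (k + 1) → ℝ) (L : List (Fin k))
    (f : (Fin (k + 1) → ℤ) → ℝ) (x : ℤ) (m : Fin k → ℤ) :
    (L.foldr (fun i g => nablaX (b i.succ) i.succ g) f) (Fin.cons x m : Fin (k + 1) → ℤ) =
      (L.foldr (fun i g => nablaX (b i.succ) i g)
        (fun m' => f (Fin.cons x m' : Fin (k + 1) → ℤ))) m := by
  induction L generalizing m with
  | nil => rfl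
  | cons i L ih =>
    simp only [List.foldr_cons, nablaX, ← Fin.cons_update, ih, Fin.cons_succ]

lemma foldr_nablaX_eq_wordExpand (a : ℤ → ℝ) {k : ℕ} (n : Fin k → ℤ) (F : List ℤ → ℝ) :
    ((List.finRange k).foldr (fun i g => nablaX (a (n i)) i g) (fun m => F (List.ofFn m))) n =
      wordExpand a (List.ofFn n) F := by
  induction k generalizing F with
  | zero => simp [wordExpand]
  | succ k ih =>
    have key : ∀ x : ℤ, ((List.finRange k).foldr (fun i g => nablaX (a (n i.succ)) i.succ g)
        (fun m => F (List.ofFn m))) (Fin.cons x (Fin.tail n) : Fin (k + 1) → ℤ) =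
        wordExpand a (List.ofFn (Fin.tail n)) (fun w => F (x :: w)) := by
      intro x
      rw [foldr_nablaX_cons (fun i => a (n i)), ← ih]
      simp [List.ofFn_succ, Fin.tail]
    have e1 : n = (Fin.cons (n 0) (Fin.tail n) : Fin (k + 1) → ℤ) := (Fin.cons_self_tail n).symm
    have e2 : Function.update n 0 (n 0 - 1) =
        (Fin.cons (n 0 - 1) (Fin.tail n) : Fin (k + 1) → ℤ) := by
      rw [← Fin.update_cons_zero (n 0), Fin.cons_self_tail]
    have k1 := key (n 0)
    rw [← e1] at k1
    rw [List.finRange_succ, List.foldr_cons, List.foldr_map, List.ofFn_succ, wordExpand, nablaX,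
      e2, key, k1]
    rfl

lemma ofFn_eq_sortedWord {N k : ℕ} {n : Fin k → ℤ} (hmono : Antitone n) (hlb : ∀ j, 0 ≤ n j)
    (hub : ∀ j, n j ≤ (N : ℤ)) :
    List.ofFn n =
      sortedWord (fun v => (Finset.univ.filter (fun j : Fin k => n j = (v : ℤ))).card) N := by
  refine List.Perm.eq_of_pairwise (le := (· ≥ ·)) (fun x y _ _ h1 h2 => le_antisymm h2 h1) ?_
    (pairwise_sortedWord _ _) ?_
  · rw [List.pairwise_ofFn]
    exact fun i j h => hmono h.le
  · rw [List.perm_iff_count]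
    intro x
    by_cases hx : 0 ≤ x ∧ x ≤ N
    · obtain ⟨v, rfl⟩ := Int.eq_ofNat_of_zero_le hx.1
      rw [count_sortedWord, if_pos (by omega)]
      rw [List.ofFn_eq_map, List.count, List.countP_map, List.countP_eq_length_filter]
      rw [← List.toFinset_card_of_nodup ((List.nodup_finRange k).filter _)]
      congr 1
      ext j
      simp
    · rw [List.count_eq_zero_of_not_mem, List.count_eq_zero_of_not_mem]
      · exact fun h => hx (mem_sortedWord h)
      · rw [List.mem_ofFn]
        rintro ⟨j, rfl⟩
        exact hx ⟨hlb j, hub j⟩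

/-- A function of integer vectors of length `k`, viewed as a function of words which vanishes
on words of any other length. -/
noncomputable def onWords {k : ℕ} (f : (Fin k → ℤ) → ℝ) (l : List ℤ) : ℝ :=
  if l.length = k then f (fun j => l.getD j 0) else 0

lemma onWords_ofFn {k : ℕ} (f : (Fin k → ℤ) → ℝ) (m : Fin k → ℤ) :
    onWords f (List.ofFn m) = f m := by
  simp [onWords]

lemma getD_append_cons (u w : List ℤ) (x y : ℤ) (j : ℕ) :
    (u ++ x :: w).getD j 0 = if j = u.length then x else (u ++ y :: w).getD j 0 := by
  induction u generalizing j with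
  | nil => rcases j with _ | j <;> simp
  | cons b u ih =>
    rcases j with _ | j
    · simp
    · simpa using ih j

lemma exchange_onWords {q : ℝ} {k : ℕ} {f : (Fin k → ℤ) → ℝ}
    (hf : ∀ (i : ℕ) (hi : i + 1 < k) (n : Fin k → ℤ),
      n ⟨i, by omega⟩ = n ⟨i + 1, hi⟩ →
      nablaD ⟨i, by omega⟩ f n - q * nablaD ⟨i + 1, hi⟩ f n = 0) :
    Exchange q (onWords f) := by
  intro u w c
  by_cases hl : u.length + (w.length + 2) = k
  · have h := hf u.length (by omega) (fun j => (u ++ c :: c :: w).getD j 0) (by simp)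
    have e1 : Function.update (fun j : Fin k => (u ++ c :: c :: w).getD j 0)
        ⟨u.length, by omega⟩ (c - 1) = fun j : Fin k => (u ++ (c - 1) :: c :: w).getD j 0 := by
      ext ⟨j, hj⟩
      simp only [Function.update_apply, Fin.mk.injEq, getD_append_cons u (c :: w) (c - 1) c]
    have e2 : Function.update (fun j : Fin k => (u ++ c :: c :: w).getD j 0)
        ⟨u.length + 1, by omega⟩ (c - 1) = fun j : Fin k => (u ++ c :: (c - 1) :: w).getD j 0 := by
      ext ⟨j, hj⟩
      have := getD_append_cons (u ++ [c]) w (c - 1) c j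
      simp only [List.append_assoc, List.singleton_append, List.length_append,
        List.length_singleton] at this
      simp only [Function.update_apply, Fin.mk.injEq, this]
    have v1 : (u ++ c :: c :: w).getD u.length 0 = c := by simp
    have v2 : (u ++ c :: c :: w).getD (u.length + 1) 0 = c := by simp
    simp only [nablaD, v1, v2, e1, e2] at h
    simp only [onWords, List.length_append, List.length_cons, add_assoc, Nat.reduceAdd, if_pos hl]
    linarith
  · simp [onWords, add_assoc, hl]

theorem stmt_8 (q : ℝ) (hq : q ∈ Set.Ioo (0:ℝ) 1) (N k : ℕ) (hN : 1 ≤ N) (hk : 1 ≤ k)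
    (a : ℤ → ℝ) (f : (Fin k → ℤ) → ℝ)
    (hf : ∀ (i : ℕ) (hi : i + 1 < k) (n : Fin k → ℤ),
      n ⟨i, by omega⟩ = n ⟨i + 1, hi⟩ →
      nablaD ⟨i, by omega⟩ f n - q * nablaD ⟨i + 1, hi⟩ f n = 0)
    (n : Fin k → ℤ) (hmono : Antitone n) (hlb : ∀ j, 1 ≤ n j) (hub : ∀ j, n j ≤ (N : ℤ)) :
    ((List.finRange k).foldr (fun i g => nablaX (a (n i)) i g) f) n
      = ∑ s ∈ Fintype.piFinset (fun i : Fin N => Finset.range (ycount N n i.succ + 1)),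
          (∏ i : Fin N, Cco q (a ((i : ℕ) + 1)) (ycount N n i.succ) (s i : ℤ))
            * f (fun j => (nvec N k (yshift (ycount N n) s) j : ℤ)) := by
  set y : ℕ → ℕ := fun v => (Finset.univ.filter (fun j : Fin k => n j = (v : ℤ))).card with hy
  have hy0 : y 0 = 0 := by
    rw [hy, Finset.card_eq_zero, Finset.filter_eq_empty_iff]
    intro j _ h
    have := hlb j
    simp at h
    omega
  have hyc : ∀ i : Fin N, ycount N n i.succ = y (i + 1) := fun i => by simp [ycount, hy]
  have hword := ofFn_eq_sortedWord hmono (fun j => zero_le_one.trans (hlb j)) hub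
  have hlen : (sortedWord y N).length = k := by rw [← hword, List.length_ofFn]
  have hexp := foldr_nablaX_eq_wordExpand a n (onWords f)
  simp only [onWords_ofFn] at hexp
  rw [hexp, hword, wordExpand_sortedWord hq a y hy0 N (exchange_onWords hf)]
  simp only [hyc]
  refine Finset.sum_congr rfl fun s hs => ?_
  congr 1
  have hs' : ∀ i : Fin N, s i ≤ y (i + 1) := fun i => by
    simpa [Nat.lt_succ_iff] using Fintype.mem_piFinset.1 hs i
  have hlow : loweredWord y (extendZero s) N = _ :=
    replicate_append_loweredWord y (extendZero s) hy0 N 0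
  have hlenl : (loweredWord y (extendZero s) N).length = k := by
    rw [length_loweredWord hy0 fun v hv => by simpa [extendZero, hv] using hs' ⟨v, hv⟩, hlen]
  rw [onWords, if_pos hlenl]
  congr 1
  ext j
  rw [hlow, ← nvec_eq_getD_sortedWord]
  congr 2
  ext v
  rcases v with ⟨v, hv⟩
  rcases v with _ | v
  · simp [yshift, ycount, extendZero, hy, show 0 < N by omega]
  · have h1 : v < N := by omega
    by_cases h2 : v + 1 < N <;> simp [yshift, ycount, extendZero, hy, h1, h2]
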